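/- In the closed-loop least-squares setup, if the set {x ∈ ℝ : |f(x)| > 0} has positive Lebesgue measure, then liminf_{t→+∞} r_t/t > 0 almost surely. -/

import Mathlib

open MeasureTheory ProbabilityTheory Filter

lemma aux_set (f : ℝ → ℝ) (hf : Measurable f) (hpos : 0 < volume {x : ℝ | 0 < |f x|}) :
    ∃ (A : Set ℝ) (ε M : ℝ), MeasurableSet A ∧ 0 < ε ∧ (∀ x ∈ A, ε ≤ |f x|) ∧
      (∀ x ∈ A, |x| ≤ M) ∧ 0 < volume A ∧ volume A ≠ ⊤ := by
  by_contra! hcon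
  have hfm : Measurable fun x => |f x| := hf.abs
  have hnull : ∀ n : ℕ, volume {x : ℝ | 1 / ((n : ℝ) + 1) ≤ |f x| ∧ |x| ≤ n} = 0 := by
    intro n
    by_contra h0
    have hm : MeasurableSet {x : ℝ | 1 / ((n : ℝ) + 1) ≤ |f x| ∧ |x| ≤ n} :=
      (measurableSet_le measurable_const hfm).inter
        (measurableSet_le measurable_id.abs measurable_const)
    have := hcon _ (1 / ((n : ℝ) + 1)) n hm (by positivity) (fun x hx => hx.1)
      (fun x hx => hx.2) (pos_iff_ne_zero.mpr h0)
    have hle : volume {x : ℝ | 1 / ((n : ℝ) + 1) ≤ |f x| ∧ |x| ≤ n}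
        ≤ volume (Set.Icc (-(n : ℝ)) n) :=
      measure_mono (fun x hx => abs_le.mp hx.2)
    rw [this, Real.volume_Icc] at hle
    exact absurd hle (by simp)
  have hU := measure_iUnion_null hnull
  have hsub : {x : ℝ | 0 < |f x|} ⊆ ⋃ n : ℕ, {x : ℝ | 1 / ((n : ℝ) + 1) ≤ |f x| ∧ |x| ≤ n} := by
    intro x hx
    obtain ⟨n, hn⟩ := exists_nat_one_div_lt (show 0 < |f x| from hx)
    obtain ⟨m, hm⟩ := exists_nat_ge |x|
    refine Set.mem_iUnion.mpr ⟨max n m, ?_, ?_⟩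
    · refine le_trans ?_ hn.le
      apply one_div_le_one_div_of_le (by positivity)
      have : (n : ℝ) ≤ ((max n m : ℕ) : ℝ) := by exact_mod_cast le_max_left n m
      linarith
    · exact hm.trans (by exact_mod_cast le_max_right n m)
  exact hpos.ne' (measure_mono_null hsub hU)

/-- Lower bound on the Gaussian probability. -/
lemma aux_gauss (A : Set ℝ) (M s : ℝ) (hA : MeasurableSet A) (hM : ∀ x ∈ A, |x| ≤ M)
    (hfin : volume A ≠ ⊤) (hs : 1 ≤ s) :
    ((2 * Real.pi) ^ (-(1 : ℝ) / 2) * (Real.exp (-M ^ 2 / 2) * volume.real A)) *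
      Real.exp (-(Real.log s / 2)) ≤
    (2 * Real.pi * s) ^ (-(1 : ℝ) / 2) * ∫ x in A, Real.exp (-x ^ 2 / (2 * s)) := by
  have hs0 : 0 < s := by linarith
  have h1 : (2 * Real.pi * s) ^ (-(1 : ℝ) / 2)
      = (2 * Real.pi) ^ (-(1 : ℝ) / 2) * Real.exp (-(Real.log s / 2)) := by
    rw [Real.mul_rpow (by positivity) hs0.le, Real.rpow_def_of_pos hs0]
    congr 2; ring
  have h2 : Real.exp (-M ^ 2 / 2) * volume.real A ≤ ∫ x in A, Real.exp (-x ^ 2 / (2 * s)) := by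
    have hint : IntegrableOn (fun x : ℝ => Real.exp (-x ^ 2 / (2 * s))) A := by
      refine Measure.integrableOn_of_bounded (M := 1) hfin (by fun_prop) ?_
      refine Eventually.of_forall fun x => ?_
      rw [Real.norm_eq_abs, abs_of_pos (Real.exp_pos _)]
      apply Real.exp_le_one_iff.mpr
      rw [neg_div]
      have : 0 ≤ x ^ 2 / (2 * s) := by positivity
      linarith
    have hc : Real.exp (-M ^ 2 / 2) * volume.real A = ∫ x in A, Real.exp (-M ^ 2 / 2) := by
      rw [setIntegral_const, smul_eq_mul, mul_comm]
    rw [hc]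
    refine setIntegral_mono_on (integrableOn_const hfin) hint hA fun x hx => ?_
    apply Real.exp_le_exp.mpr
    rw [neg_div, neg_div, neg_le_neg_iff]
    have hx2 : x ^ 2 ≤ M ^ 2 := sq_le_sq' (abs_le.mp (hM x hx)).1 (abs_le.mp (hM x hx)).2
    exact div_le_div₀ (by positivity) hx2 (by norm_num) (by linarith)
  rw [h1]
  have : 0 ≤ (2 * Real.pi) ^ (-(1 : ℝ) / 2) * Real.exp (-(Real.log s / 2)) := by positivity
  calc _ = (2 * Real.pi) ^ (-(1 : ℝ) / 2) * Real.exp (-(Real.log s / 2)) *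
        (Real.exp (-M ^ 2 / 2) * volume.real A) := by ring
    _ ≤ _ := mul_le_mul_of_nonneg_left h2 this

/-- Pointwise one-step bound. -/
lemma aux_step (k c a L q : ℝ) (hk : 0 ≤ k) (ha : a = k * c) (ha0 : 0 ≤ a)
    (hq : c * Real.exp (-(L / 2)) ≤ q) :
    Real.exp (a - a / 2 * L) * (1 - k * q) ≤ 1 := by
  have h1 : 1 - k * q ≤ Real.exp (-(a * Real.exp (-(L / 2)))) := by
    have := Real.add_one_le_exp (-(a * Real.exp (-(L / 2))))
    have h2 := mul_le_mul_of_nonneg_left hq hk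
    rw [← mul_assoc, ← ha] at h2
    linarith
  refine (mul_le_mul_of_nonneg_left h1 (Real.exp_pos _).le).trans ?_
  rw [← Real.exp_add]
  apply Real.exp_le_one_iff.mpr
  have h3 := mul_le_mul_of_nonneg_left (Real.add_one_le_exp (-(L / 2))) ha0
  linarith

/-- Lemma 5: in the closed-loop least-squares setup, if `{x : |f x| > 0}` has positive
Lebesgue measure then `liminf r t / t > 0` almost surely. -/
theorem stmt_10
    {Ω : Type*} [MeasurableSpace Ω] (P : Measure Ω) [IsProbabilityMeasure P]
    (y : ℕ → Ω → ℝ) (hy : ∀ t, Measurable (y t))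
    (f : ℝ → ℝ) (hf : Measurable f)
    (P₀ : ℝ) (hP₀ : 0 < P₀)
    (R σ2 : ℕ → Ω → ℝ)
    (hR : ∀ t ω, R t ω = P₀⁻¹ + ∑ i ∈ Finset.range t, (f (y i ω)) ^ 2)
    (hσ2 : ∀ t ω, σ2 t ω = R (t + 1) ω / R t ω)
    (𝔉 : ℕ → MeasurableSpace Ω)
    (h𝔉 : ∀ t, 𝔉 t = ⨆ i : Fin (t + 1), MeasurableSpace.comap (y i) inferInstance)
    (hGauss : ∀ t : ℕ, ∀ A : Set ℝ, MeasurableSet A →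
      (P[Set.indicator {ω | y (t + 1) ω ∈ A} (fun _ => (1 : ℝ))|𝔉 t]) =ᵐ[P]
        fun ω => (2 * Real.pi * σ2 t ω) ^ (-(1 : ℝ) / 2) *
          ∫ x in A, Real.exp (-x ^ 2 / (2 * σ2 t ω)))
    (hpos : 0 < volume {x : ℝ | 0 < |f x|}) :
    ∀ᵐ ω ∂P, (0 : EReal) < Filter.liminf
      (fun t : ℕ => ((R (t + 1) ω / t : ℝ) : EReal)) Filter.atTop := by
  classical
  obtain ⟨A, ε, M, hA, hε, hfA, hAM, hA0, hAfin⟩ := aux_set f hf hpos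
  set c : ℝ := (2 * Real.pi) ^ (-(1 : ℝ) / 2) * (Real.exp (-M ^ 2 / 2) * volume.real A) with hc
  have hvA : 0 < volume.real A := ENNReal.toReal_pos hA0.ne' hAfin
  have hc0 : 0 < c := by positivity
  set k : ℝ := 1 - Real.exp (-1) with hk
  have hk0 : 0 < k := by
    have : Real.exp (-1) < 1 := Real.exp_lt_one_iff.mpr (by norm_num)
    linarith
  set a : ℝ := k * c with ha
  have ha0 : 0 < a := by positivity
  have hRpos : ∀ t ω, 0 < R t ω := by
    intro t ω; rw [hR]
    have : 0 ≤ ∑ i ∈ Finset.range t, (f (y i ω)) ^ 2 := Finset.sum_nonneg fun i _ => sq_nonneg _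
    have := inv_pos.mpr hP₀
    linarith
  have hRsucc : ∀ t ω, R (t + 1) ω = R t ω + f (y t ω) ^ 2 := by
    intro t ω; rw [hR, hR, Finset.sum_range_succ]; ring
  have hRle : ∀ t ω, R t ω ≤ R (t + 1) ω := by
    intro t ω; rw [hRsucc]; nlinarith [sq_nonneg (f (y t ω))]
  have hR0le : ∀ t ω, R 0 ω ≤ R t ω := by
    intro t ω
    induction t with
    | zero => exact le_rfl
    | succ n ih => exact ih.trans (hRle n ω)
  -- measurability
  have h𝔉le : ∀ t, 𝔉 t ≤ ‹MeasurableSpace Ω› := by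
    intro t; rw [h𝔉]; exact iSup_le fun i => (hy i).comap_le
  have hym : ∀ t i, i ≤ t → Measurable[𝔉 t] (y i) := by
    intro t i hi
    have h1 : MeasurableSpace.comap (y i) inferInstance ≤ 𝔉 t := by
      rw [h𝔉]
      exact le_iSup (fun j : Fin (t + 1) => MeasurableSpace.comap (y j) inferInstance)
        ⟨i, Nat.lt_succ_of_le hi⟩
    exact Measurable.mono (comap_measurable (y i)) h1 le_rfl
  have hRm : ∀ t s, s ≤ t + 1 → Measurable[𝔉 t] (R s) := by
    intro t s hs
    have : R s = fun ω => P₀⁻¹ + ∑ i ∈ Finset.range s, (f (y i ω)) ^ 2 := funext (hR s)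
    rw [this]
    refine Measurable.const_add (Finset.measurable_fun_sum _ fun i hi => ?_) _
    have hi' := Finset.mem_range.mp hi
    exact (hf.comp (hym t i (by omega))).pow_const 2
  set I : ℕ → Ω → ℝ := fun t => Set.indicator {ω | y t ω ∈ A} (fun _ => (1 : ℝ)) with hI
  have hIm : ∀ t s, s ≤ t → Measurable[𝔉 t] (I s) := fun t s hs =>
    Measurable.indicator measurable_const (hym t s hs hA)
  have hI01 : ∀ t ω, 0 ≤ I t ω ∧ I t ω ≤ 1 := by
    intro t ω
    by_cases h : ω ∈ {ω | y t ω ∈ A} <;> simp [hI, h]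
  have hIexp : ∀ t ω, Real.exp (-(I t ω)) = 1 - k * I t ω := by
    intro t ω
    by_cases h : y t ω ∈ A <;> simp [hI, h, hk]
  set N : ℕ → Ω → ℝ := fun T ω => ∑ i ∈ Finset.range T, I (i + 1) ω with hN
  set Z : ℕ → Ω → ℝ := fun T ω =>
    Real.exp (-(N T ω) + a * T - a / 2 * (Real.log (R T ω) - Real.log (R 0 ω))) with hZ
  set W : ℕ → Ω → ℝ := fun T ω =>
    Real.exp (a - a / 2 * (Real.log (R (T + 1) ω) - Real.log (R T ω))) with hW
  have hNm : ∀ T, Measurable[𝔉 T] (N T) := by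
    intro T
    refine Finset.measurable_fun_sum _ fun i hi => ?_
    have hi' := Finset.mem_range.mp hi
    exact hIm T (i + 1) (by omega)
  have hZm : ∀ T, Measurable[𝔉 T] (Z T) := by
    intro T
    have h1 := hNm T
    have h2 := hRm T T (by omega)
    have h3 := hRm T 0 (by omega)
    exact Real.measurable_exp.comp ((h1.neg.add_const _).sub
      (((Real.measurable_log.comp h2).sub (Real.measurable_log.comp h3)).const_mul _))
  have hWm : ∀ T, Measurable[𝔉 T] (W T) := by
    intro T
    have h2 := hRm T (T + 1) (by omega)
    have h3 := hRm T T (by omega)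
    exact Real.measurable_exp.comp
      ((((Real.measurable_log.comp h2).sub (Real.measurable_log.comp h3)).const_mul _).const_sub _)
  have hZW : ∀ T ω, Z (T + 1) ω = (Z T ω * W T ω) * (1 - k * I (T + 1) ω) := by
    intro T ω
    rw [← hIexp]
    simp only [hZ, hW, hN]
    rw [← Real.exp_add, ← Real.exp_add, Finset.sum_range_succ]
    congr 1
    push_cast
    ring
  have hZ0 : ∀ T ω, 0 < Z T ω := fun T ω => Real.exp_pos _
  have hW0 : ∀ T ω, 0 < W T ω := fun T ω => Real.exp_pos _
  have hNnn : ∀ T ω, 0 ≤ N T ω := fun T ω => Finset.sum_nonneg fun i _ => (hI01 _ _).1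
  have hZle : ∀ T ω, Z T ω ≤ Real.exp (a * T) := by
    intro T ω
    apply Real.exp_le_exp.mpr
    have h1 := Real.log_le_log (hRpos 0 ω) (hR0le T ω)
    have h2 : 0 ≤ a / 2 * (Real.log (R T ω) - Real.log (R 0 ω)) :=
      mul_nonneg (by positivity) (by linarith)
    have := hNnn T ω
    linarith
  have hWle : ∀ T ω, W T ω ≤ Real.exp a := by
    intro T ω
    apply Real.exp_le_exp.mpr
    have h1 := Real.log_le_log (hRpos T ω) (hRle T ω)
    have h2 : 0 ≤ a / 2 * (Real.log (R (T + 1) ω) - Real.log (R T ω)) :=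
      mul_nonneg (by positivity) (by linarith)
    linarith
  have hZint : ∀ T, Integrable (Z T) P := by
    intro T
    refine Integrable.of_bound ((hZm T).mono (h𝔉le T) le_rfl).aestronglyMeasurable
      (Real.exp (a * T)) (Eventually.of_forall fun ω => ?_)
    rw [Real.norm_eq_abs, abs_of_pos (hZ0 T ω)]; exact hZle T ω
  have hZWint : ∀ T, Integrable (fun ω => Z T ω * W T ω) P := by
    intro T
    refine Integrable.of_bound (((hZm T).mul (hWm T)).mono (h𝔉le T) le_rfl).aestronglyMeasurable
      (Real.exp (a * T) * Real.exp a) (Eventually.of_forall fun ω => ?_)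
    rw [Real.norm_eq_abs, abs_of_pos (mul_pos (hZ0 T ω) (hW0 T ω))]
    exact mul_le_mul (hZle T ω) (hWle T ω) (hW0 T ω).le (Real.exp_pos _).le
  have hIint : ∀ t, Integrable (I t) P := by
    intro t
    refine Integrable.of_bound ((hIm t t le_rfl).mono (h𝔉le t) le_rfl).aestronglyMeasurable
      1 (Eventually.of_forall fun ω => ?_)
    rw [Real.norm_eq_abs, abs_of_nonneg (hI01 t ω).1]; exact (hI01 t ω).2
  have hZWIint : ∀ T, Integrable (fun ω => (Z T ω * W T ω) * I (T + 1) ω) P := by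
    intro T
    refine (hZWint T).mul_bdd (c := 1)
      ((hIm (T + 1) (T + 1) le_rfl).mono (h𝔉le (T + 1)) le_rfl).aestronglyMeasurable
      (Eventually.of_forall fun ω => ?_)
    rw [Real.norm_eq_abs, abs_of_nonneg (hI01 _ ω).1]; exact (hI01 _ ω).2
  have hstep : ∀ T, ∫ ω, Z (T + 1) ω ∂P ≤ ∫ ω, Z T ω ∂P := by
    intro T
    have hcond : P[fun ω => (Z T ω * W T ω) * I (T + 1) ω|𝔉 T] =ᵐ[P]
        fun ω => (Z T ω * W T ω) * (P[I (T + 1)|𝔉 T]) ω :=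
      condExp_mul_of_stronglyMeasurable_left ((hZm T).mul (hWm T)).stronglyMeasurable
        (hZWIint T) (hIint (T + 1))
    have hE : ∫ ω, (Z T ω * W T ω) * I (T + 1) ω ∂P
        = ∫ ω, (Z T ω * W T ω) * (P[I (T + 1)|𝔉 T]) ω ∂P := by
      rw [← integral_condExp (h𝔉le T)]
      exact integral_congr_ae hcond
    have hint2 : Integrable (fun ω => (Z T ω * W T ω) * (P[I (T + 1)|𝔉 T]) ω) P :=
      integrable_condExp.congr hcond
    have e1 : ∫ ω, Z (T + 1) ω ∂P
        = ∫ ω, (Z T ω * W T ω - k * ((Z T ω * W T ω) * (P[I (T + 1)|𝔉 T]) ω)) ∂P := by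
      rw [integral_sub (hZWint T) (hint2.const_mul k), integral_const_mul, ← hE,
        ← integral_const_mul, ← integral_sub (hZWint T) ((hZWIint T).const_mul k)]
      refine integral_congr_ae (Eventually.of_forall fun ω => ?_)
      simp only [hZW]; ring
    rw [e1]
    refine integral_mono_ae ((hZWint T).sub (hint2.const_mul k)) (hZint T) ?_
    filter_upwards [hGauss T A hA] with ω hω
    have hσ1 : 1 ≤ σ2 T ω := by
      rw [hσ2, one_le_div (hRpos T ω)]; exact hRle T ω
    have hq := aux_gauss A M (σ2 T ω) hA hAM hAfin hσ1
    rw [← hω] at hq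
    have hlog : Real.log (σ2 T ω) = Real.log (R (T + 1) ω) - Real.log (R T ω) := by
      rw [hσ2, Real.log_div (hRpos _ ω).ne' (hRpos _ ω).ne']
    have hs := aux_step k c a _ _ hk0.le ha ha0.le hq
    rw [hlog] at hs
    have hs' := mul_le_mul_of_nonneg_left hs (hZ0 T ω).le
    calc _ = Z T ω * (W T ω * (1 - k * (P[I (T + 1)|𝔉 T]) ω)) := by ring
      _ ≤ Z T ω * 1 := hs'
      _ = Z T ω := mul_one _
  have hEZ : ∀ T, ∫ ω, Z T ω ∂P ≤ 1 := by
    intro T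
    induction T with
    | zero => simp [hZ, hN]
    | succ n ih => exact (hstep n).trans ih
  have hMarkov : ∀ T : ℕ, P {ω | Real.exp (a / 2 * T) ≤ Z T ω}
      ≤ ENNReal.ofReal (Real.exp (-(a / 2)) ^ T) := by
    intro T
    have h1 := mul_meas_ge_le_integral_of_nonneg
      (Eventually.of_forall fun ω => (hZ0 T ω).le) (hZint T) (Real.exp (a / 2 * T))
    have h2 := h1.trans (hEZ T)
    rw [← ofReal_measureReal]
    apply ENNReal.ofReal_le_ofReal
    rw [← Real.exp_nat_mul, show (T : ℝ) * -(a / 2) = -(a / 2 * T) by ring, Real.exp_neg,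
      inv_eq_one_div, le_div_iff₀ (Real.exp_pos _), mul_comm]
    exact h2
  have hsum : ∑' T : ℕ, P {ω | Real.exp (a / 2 * T) ≤ Z T ω} ≠ ⊤ := by
    refine ne_top_of_le_ne_top ?_ (ENNReal.tsum_le_tsum hMarkov)
    have hsm : Summable fun T : ℕ => Real.exp (-(a / 2)) ^ T :=
      summable_geometric_of_lt_one (Real.exp_pos _).le (Real.exp_lt_one_iff.mpr (by linarith))
    exact hsm.tsum_ofReal_ne_top
  have hBC := ae_eventually_notMem hsum
  filter_upwards [hBC] with ω hω
  have hR00 : R 0 ω = P₀⁻¹ := by simp [hR]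
  have hNR : ∀ T, ε ^ 2 * N T ω ≤ R (T + 1) ω := by
    intro T
    rw [hR, Finset.sum_range_succ']
    have h1 : ε ^ 2 * N T ω ≤ ∑ i ∈ Finset.range T, f (y (i + 1) ω) ^ 2 := by
      simp only [hN]
      rw [Finset.mul_sum]
      refine Finset.sum_le_sum fun i _ => ?_
      by_cases h : y (i + 1) ω ∈ A
      · have := hfA _ h
        simp only [hI, Set.indicator, Set.mem_ofPred_eq, h, if_true, mul_one]
        rw [← sq_abs (f _)]
        exact pow_le_pow_left₀ hε.le this 2
      · simp only [hI, Set.indicator, Set.mem_ofPred_eq, h, if_false, mul_zero]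
        positivity
    have := inv_pos.mpr hP₀
    nlinarith [sq_nonneg (f (y 0 ω))]
  have hlogT : ∀ᶠ T : ℕ in atTop, Real.log T - Real.log (R 0 ω) ≤ T / 2 := by
    have h1 : Tendsto (fun T : ℕ => Real.log T / (T : ℝ)) atTop (nhds 0) := by
      have := Real.isLittleO_log_id_atTop.tendsto_div_nhds_zero
      exact this.comp tendsto_natCast_atTop_atTop
    have h2 : Tendsto (fun T : ℕ => -Real.log (R 0 ω) / (T : ℝ)) atTop (nhds 0) :=
      tendsto_const_div_atTop_nhds_zero_nat _
    have h3 := (h1.add h2).eventually_le_const (show (0 : ℝ) + 0 < 1 / 2 by norm_num)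
    filter_upwards [h3, eventually_gt_atTop 0] with T hT hT0
    have hT0' : (0 : ℝ) < T := by exact_mod_cast hT0
    rw [← add_div, div_le_iff₀ hT0'] at hT
    linarith
  set δ : ℝ := min 1 (ε ^ 2 * (a / 4)) with hδ
  have hδ0 : 0 < δ := by positivity
  have hev : ∀ᶠ T : ℕ in atTop, (δ : EReal) ≤ ((R (T + 1) ω / T : ℝ) : EReal) := by
    filter_upwards [hω, hlogT, eventually_gt_atTop 0] with T h1 h2 hT0
    have hT0' : (0 : ℝ) < T := by exact_mod_cast hT0
    rw [EReal.coe_le_coe_iff, le_div_iff₀ hT0']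
    by_cases hc : (T : ℝ) ≤ R (T + 1) ω
    · have : δ * T ≤ 1 * T := mul_le_mul_of_nonneg_right (min_le_left _ _) hT0'.le
      linarith
    · push Not at hc
      have hZlt : Z T ω < Real.exp (a / 2 * T) := by simpa using h1
      have h3 := Real.exp_lt_exp.mp hZlt
      have h4 : Real.log (R T ω) ≤ Real.log T :=
        Real.log_le_log (hRpos T ω) ((hRle T ω).trans hc.le)
      have h5 : a / 2 * (Real.log (R T ω) - Real.log (R 0 ω)) ≤ a / 2 * (T / 2) :=
        mul_le_mul_of_nonneg_left (by linarith) (by positivity)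
      have h6 : a / 4 * T ≤ N T ω := by linarith
      have h7 := mul_le_mul_of_nonneg_left h6 (sq_nonneg ε)
      have : δ * T ≤ (ε ^ 2 * (a / 4)) * T :=
        mul_le_mul_of_nonneg_right (min_le_right _ _) hT0'.le
      have := hNR T
      linarith
  exact lt_of_lt_of_le (by exact_mod_cast hδ0) (le_liminf_of_le (by isBoundedDefault) hev)
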